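/- arXiv:1303.2274 — 3 statements merged into one kernel-verified Lean document; each statement's English description precedes it below -/
import Mathlib

section
/- One has q > 0, and the rational vector (a_1, …, a_l) with a_i := 1 − (u_i + v_i)/q satisfies the linear system M(−n_1, …, −n_l)·(a_1, …, a_l)ᵀ = (2 − n_1, …, 2 − n_l)ᵀ over ℚ. (That is, the discrepancies of the cyclic quotient singularity of type [n_1, …, n_l] are a_i = 1 − (u_i + v_i)/q.) -/
/-- The `l × l` symmetric tridiagonal intersection matrix `M(-n₁, …, -n_l)`,
where the entries `n 1, …, n l` of `n : ℕ → ℤ` are used (1-based indexing). -/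
def HJMat (l : ℕ) (n : ℕ → ℤ) : Matrix (Fin l) (Fin l) ℤ :=
  Matrix.of fun i j =>
    if i = j then -(n (i.val + 1))
    else if i.val + 1 = j.val ∨ j.val + 1 = i.val then 1 else 0

/-- `|[n₁, …, n_l]| = |det M(-n₁, …, -n_l)|` (with `|[]| = 1` for `l = 0`). -/
def HJdet (l : ℕ) (n : ℕ → ℤ) : ℤ := |(HJMat l n).det|

/-- `u`-sequence: `u 0 = 0` and `u s = |[n₁, …, n_{s-1}]|` for `s ≥ 1`. -/
def HJu (n : ℕ → ℤ) : ℕ → ℤ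
  | 0 => 0
  | s + 1 => HJdet s n

/-- `v`-sequence: `v s = |[n_{s+1}, …, n_l]|` for `0 ≤ s ≤ l`, and `v s = 0` for `s > l`. -/
def HJv (l : ℕ) (n : ℕ → ℤ) (s : ℕ) : ℤ :=
  if s ≤ l then HJdet (l - s) (fun i => n (s + i)) else 0

/-- `q = |[n₁, …, n_l]|`. -/
def HJq (l : ℕ) (n : ℕ → ℤ) : ℤ := HJdet l n

/-- The continuant `(-1)^l det M(-n₁, …, -n_l)`. -/
def HJcont (l : ℕ) (n : ℕ → ℤ) : ℤ := (-1) ^ l * (HJMat l n).det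

theorem HJMat_det_succ_succ (l : ℕ) (n : ℕ → ℤ) :
    (HJMat (l + 2) n).det =
      -(n 1) * (HJMat (l + 1) fun i => n (i + 1)).det - (HJMat l fun i => n (i + 2)).det := by
  have minor_zero : (HJMat (l + 2) n).submatrix Fin.succ (Fin.succAbove 0)
      = HJMat (l + 1) fun i => n (i + 1) := by
    ext i j
    simp [HJMat]
  have minor_one : ((HJMat (l + 2) n).submatrix Fin.succ
      (Fin.succAbove (Fin.succ 0))).det = (HJMat l fun i => n (i + 2)).det := by
    rw [Matrix.det_succ_column_zero, Fin.sum_univ_succ, Finset.sum_eq_zero, add_zero]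
    · have minor : ((HJMat (l + 2) n).submatrix Fin.succ (Fin.succAbove (Fin.succ 0))).submatrix
          (Fin.succAbove 0) Fin.succ = HJMat l fun i => n (i + 2) := by
        ext i j
        simp [HJMat]
      rw [minor]
      simp [HJMat]
    · intro i _
      simp [HJMat, Fin.ext_iff]
  rw [Matrix.det_succ_row_zero, Fin.sum_univ_succ, Fin.sum_univ_succ, Finset.sum_eq_zero,
    minor_zero, minor_one]
  · simp [HJMat]
    ring
  · intro i _
    simp [HJMat, Fin.ext_iff]

theorem HJcont_zero (n : ℕ → ℤ) : HJcont 0 n = 1 := by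
  simp [HJcont]

theorem HJcont_one (n : ℕ → ℤ) : HJcont 1 n = n 1 := by
  simp [HJcont, HJMat]

theorem HJcont_succ_succ (l : ℕ) (n : ℕ → ℤ) :
    HJcont (l + 2) n =
      n 1 * HJcont (l + 1) (fun i => n (i + 1)) - HJcont l fun i => n (i + 2) := by
  simp only [HJcont, HJMat_det_succ_succ]
  ring

/-- The continuant satisfies the same recursion at its last entry. -/
theorem HJcont_succ_succ_last (l : ℕ) (n : ℕ → ℤ) :
    HJcont (l + 2) n = n (l + 2) * HJcont (l + 1) n - HJcont l n := by
  induction l using Nat.strong_induction_on generalizing n with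
  | _ l ih =>
    match l with
    | 0 =>
      simp [HJcont_succ_succ, HJcont_zero, HJcont_one]
      ring
    | 1 =>
      simp [HJcont_succ_succ, HJcont_zero, HJcont_one]
      ring
    | l + 2 =>
      rw [HJcont_succ_succ, ih (l + 1) (by omega), ih l (by omega) fun i => n (i + 2),
        HJcont_succ_succ (l + 1) n, HJcont_succ_succ l n]
      ring

theorem HJcont_pos_and_lt (l : ℕ) (n : ℕ → ℤ) (hn : ∀ i, 1 ≤ i → i ≤ l + 1 → 2 ≤ n i) :
    0 < HJcont l n ∧ HJcont l n < HJcont (l + 1) n := by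
  induction l with
  | zero =>
    have := hn 1 le_rfl le_rfl
    rw [HJcont_zero, HJcont_one]
    omega
  | succ l ih =>
    obtain ⟨hpos, hlt⟩ := ih fun i h₁ h₂ => hn i h₁ (by omega)
    have hlast := hn (l + 2) (by omega) le_rfl
    rw [HJcont_succ_succ_last]
    exact ⟨by omega, by nlinarith⟩

theorem HJcont_pos (l : ℕ) (n : ℕ → ℤ) (hn : ∀ i, 1 ≤ i → i ≤ l → 2 ≤ n i) :
    0 < HJcont l n := by
  cases l with
  | zero => simp [HJcont_zero]
  | succ l =>
    obtain ⟨hpos, hlt⟩ := HJcont_pos_and_lt l n hn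
    exact hpos.trans hlt

theorem HJdet_eq_HJcont (l : ℕ) (n : ℕ → ℤ) (hn : ∀ i, 1 ≤ i → i ≤ l → 2 ≤ n i) :
    HJdet l n = HJcont l n := by
  rw [← abs_of_pos (HJcont_pos l n hn), HJdet, HJcont, abs_mul, abs_pow, abs_neg, abs_one,
    one_pow, one_mul]

theorem HJu_add_two (n : ℕ → ℤ) (s : ℕ) (hn : ∀ i, 1 ≤ i → i ≤ s + 1 → 2 ≤ n i) :
    HJu n s + HJu n (s + 2) = n (s + 1) * HJu n (s + 1) := by
  cases s with
  | zero =>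
    simp only [HJu]
    rw [HJdet_eq_HJcont _ _ hn, HJdet_eq_HJcont _ _ (by omega), HJcont_zero, HJcont_one]
    ring
  | succ s =>
    simp only [HJu]
    rw [HJdet_eq_HJcont _ _ hn, HJdet_eq_HJcont _ _ fun i h₁ h₂ => hn i h₁ (by omega),
      HJdet_eq_HJcont _ _ fun i h₁ h₂ => hn i h₁ (by omega), HJcont_succ_succ_last]
    ring

theorem HJv_add_two (l : ℕ) (n : ℕ → ℤ) (s : ℕ) (hs : s < l)
    (hn : ∀ i, 1 ≤ i → i ≤ l → 2 ≤ n i) :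
    HJv l n s + HJv l n (s + 2) = n (s + 1) * HJv l n (s + 1) := by
  have v_eq (t : ℕ) (ht : t ≤ l) : HJv l n t = HJcont (l - t) fun i => n (t + i) := by
    rw [HJv, if_pos ht, HJdet_eq_HJcont]
    exact fun i h₁ h₂ => hn _ (by omega) (by omega)
  obtain ⟨k, rfl⟩ := Nat.exists_eq_add_of_lt hs
  rw [v_eq s (by omega), v_eq (s + 1) (by omega)]
  cases k with
  | zero => simp [HJv, HJcont_zero, HJcont_one]
  | succ k =>
    rw [v_eq (s + 2) (by omega), show s + (k + 1) + 1 - s = k + 2 by omega,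
      show s + (k + 1) + 1 - (s + 1) = k + 1 by omega,
      show s + (k + 1) + 1 - (s + 2) = k by omega, HJcont_succ_succ]
    simp only [add_comm, add_left_comm]
    ring

/-- A row of `M(-n₁, …, -n_l)` applied to a vector extended by zero at both ends. -/
theorem HJMat_mulVec_apply (l : ℕ) (n : ℕ → ℤ) (f : ℕ → ℚ) (h₀ : f 0 = 0)
    (h₁ : f (l + 1) = 0) (i : Fin l) :
    ((HJMat l n).map (fun x => (x : ℚ))).mulVec (fun j => f (j.val + 1)) i
      = f i.val + f (i.val + 2) - n (i.val + 1) * f (i.val + 1) := by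
  obtain ⟨i, hi⟩ := i
  have entry (j : Fin l) : ((HJMat l n ⟨i, hi⟩ j : ℤ) : ℚ) * f (j.val + 1)
      = (if i = j.val then -(n (i + 1) : ℚ) * f (i + 1) else 0)
        + (if i + 1 = j.val then f (i + 2) else 0) + if i = j.val + 1 then f i else 0 := by
    obtain ⟨j, hj⟩ := j
    simp only [HJMat, Matrix.of_apply, Fin.mk.injEq]
    split_ifs <;> first | omega | (subst_vars; simp)
  have lower : ∑ j ∈ Finset.range l, (if i = j + 1 then f i else 0) = f i := by
    cases i with
    | zero => simp [h₀]
    | succ i => simp [show i < l by omega]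
  have upper : (if i + 1 < l then f (i + 2) else 0) = f (i + 2) := by
    split_ifs with h
    · rfl
    · rw [← h₁, show l = i + 1 by omega]
  simp only [Matrix.mulVec, dotProduct, Matrix.map_apply, entry]
  rw [Fin.sum_univ_eq_sum_range fun j =>
    (if i = j then -(n (i + 1) : ℚ) * f (i + 1) else 0)
      + (if i + 1 = j then f (i + 2) else 0) + if i = j + 1 then f i else 0]
  rw [Finset.sum_add_distrib, Finset.sum_add_distrib, lower, Finset.sum_ite_eq,
    Finset.sum_ite_eq]
  simp only [Finset.mem_range, hi, if_true, upper]
  ring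

/-- Lemma 3.8(1): `q > 0` and the discrepancies of the cyclic quotient singularity
`[n₁, …, n_l]` are `a_i = 1 - (u_i + v_i)/q`, i.e. this vector solves the linear
system `M(-n₁, …, -n_l) · a = (2 - n₁, …, 2 - n_l)ᵀ` over `ℚ`. -/
theorem hj_discrepancy_formula (l : ℕ) (n : ℕ → ℤ) (hl : 1 ≤ l)
    (hn : ∀ i, 1 ≤ i → i ≤ l → 2 ≤ n i) :
    0 < HJq l n ∧
    ((HJMat l n).map (fun x => (x : ℚ))).mulVec
        (fun i => 1 - ((HJu n (i.val + 1) : ℚ) + (HJv l n (i.val + 1) : ℚ)) / (HJq l n : ℚ))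
      = fun i => 2 - (n (i.val + 1) : ℚ) := by
  have hq : 0 < HJq l n := by
    rw [HJq, HJdet_eq_HJcont l n hn]
    exact HJcont_pos l n hn
  refine ⟨hq, funext fun i => ?_⟩
  have hq' : (HJq l n : ℚ) ≠ 0 := by exact_mod_cast hq.ne'
  rw [HJMat_mulVec_apply l n fun s => 1 - ((HJu n s : ℚ) + (HJv l n s : ℚ)) / (HJq l n : ℚ)]
  · have hu : (HJu n i + HJu n (i + 2) : ℚ) = n (i + 1) * HJu n (i + 1) := by
      exact_mod_cast HJu_add_two n i fun j h₁ h₂ => hn j h₁ (by omega)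
    have hv : (HJv l n i + HJv l n (i + 2) : ℚ) = n (i + 1) * HJv l n (i + 1) := by
      exact_mod_cast HJv_add_two l n i i.isLt hn
    field_simp
    linear_combination -hu - hv
  · have hv : HJv l n 0 = HJq l n := by simp [HJv, HJq]
    simp [hv, HJu, hq']
  · have hu : HJu n (l + 1) = HJq l n := rfl
    simp [hu, HJv, hq']
end

section
/- Let α ≥ 0, β ≥ 1, γ ≥ 0 be integers and consider the string [n_1, …, n_l] = [2, …, 2, 3, 2, …, 2, 3, 2, …, 2] with α twos, a 3, β twos, a 3, and γ twos (so l = α + β + γ + 2). Then q = αβγ + 2αβ + 3αγ + 2βγ + 5α + 4β + 5γ + 8, u_{α+1} + u_{α+2} + v_{α+1} + v_{α+2} = 2βγ + 3α + 4β + 3γ + 8, and q ≥ u_{α+1} + u_{α+2} + v_{α+1} + v_{α+2}. -/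
/-- The signed determinant `(-1)ˡ det M(-n_{s+1}, …, -n_{s+l})`: the continuant of the length-`l`
segment of `n` that starts after position `s`. -/
def hjCont (n : ℕ → ℤ) (s l : ℕ) : ℤ := (-1) ^ l * (HJMat l fun i => n (s + i)).det

theorem abs_hjCont (n : ℕ → ℤ) (s l : ℕ) : |hjCont n s l| = HJdet l fun i => n (s + i) := by
  simp [hjCont, HJdet, abs_mul]

theorem hjCont_zero (n : ℕ → ℤ) (s : ℕ) : hjCont n s 0 = 1 := by
  simp [hjCont]

theorem hjCont_one (n : ℕ → ℤ) (s : ℕ) : hjCont n s 1 = n (s + 1) := by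
  simp [hjCont, HJMat]

theorem det_HJMat_add_two (n : ℕ → ℤ) (l : ℕ) :
    (HJMat (l + 2) n).det =
      -n 1 * (HJMat (l + 1) fun i => n (1 + i)).det - (HJMat l fun i => n (2 + i)).det := by
  have h₁ : (HJMat (l + 2) n).submatrix Fin.succ (Fin.succAbove 0)
      = HJMat (l + 1) fun i => n (1 + i) := by
    ext i j
    simp [HJMat, add_comm, add_left_comm]
  have h₂ : ((HJMat (l + 2) n).submatrix Fin.succ (Fin.succAbove 1)).det
      = (HJMat l fun i => n (2 + i)).det := by
    rw [Matrix.det_succ_column_zero, Fin.sum_univ_succ, Finset.sum_eq_zero]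
    · have : ((HJMat (l + 2) n).submatrix Fin.succ (Fin.succAbove 1)).submatrix
          (Fin.succAbove 0) Fin.succ = HJMat l fun i => n (2 + i) := by
        ext i j
        have hj : (Fin.succAbove 1 j.succ : Fin (l + 2)) = j.succ.succ := by
          rw [← Fin.succ_zero_eq_one, Fin.succ_succAbove_succ, Fin.zero_succAbove]
        simp only [Matrix.submatrix_apply, Fin.zero_succAbove, hj]
        simp only [HJMat, Matrix.of_apply, Fin.succ_inj, Fin.val_succ, add_left_inj]
        rw [show i.val + 1 + 1 + 1 = 2 + (i.val + 1) by omega]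
      rw [this]
      simp [HJMat]
    · intro i _
      simp [HJMat, Fin.ext_iff]
  rw [Matrix.det_succ_row_zero, Fin.sum_univ_succ, Fin.sum_univ_succ, Finset.sum_eq_zero, h₁,
    Fin.succ_zero_eq_one, h₂]
  · simp [HJMat]
    ring
  · intro i _
    simp [HJMat, Fin.ext_iff]

theorem hjCont_add_two (n : ℕ → ℤ) (s l : ℕ) :
    hjCont n s (l + 2) = n (s + 1) * hjCont n (s + 1) (l + 1) - hjCont n (s + 2) l := by
  simp only [hjCont, det_HJMat_add_two, add_assoc]
  ring

/-- The effect on the continuant of `k` leading twos. -/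
theorem hjCont_twos_add (n : ℕ → ℤ) (s k m : ℕ) (h : ∀ i, s < i → i ≤ s + k → n i = 2) :
    hjCont n s (k + (m + 1)) =
      (k + 1) * hjCont n (s + k) (m + 1) - k * hjCont n (s + k + 1) m := by
  induction k generalizing m with
  | zero => simp
  | succ k ih =>
    rw [show k + 1 + (m + 1) = k + (m + 1 + 1) by omega,
      ih (m + 1) fun i h₁ h₂ => h i h₁ (by omega), hjCont_add_two,
      h (s + k + 1) (by omega) (by omega)]
    push_cast
    simp only [← add_assoc]
    ring

theorem hjCont_twos (n : ℕ → ℤ) (s k : ℕ) (h : ∀ i, s < i → i ≤ s + k → n i = 2) :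
    hjCont n s k = k + 1 := by
  cases k with
  | zero => simp [hjCont_zero]
  | succ k =>
    rw [hjCont_twos_add n s k 0 fun i h₁ h₂ => h i h₁ (by omega), zero_add, hjCont_one,
      hjCont_zero, h (s + k + 1) (by omega) (by omega)]
    push_cast
    ring

theorem hjCont_three_twos (n : ℕ → ℤ) (s c : ℕ) (h₃ : n (s + 1) = 3)
    (h : ∀ i, s + 1 < i → i ≤ s + 1 + c → n i = 2) : hjCont n s (c + 1) = 2 * c + 3 := by
  cases c with
  | zero => simp [hjCont_one, h₃]
  | succ c =>
    rw [hjCont_add_two, h₃, hjCont_twos n (s + 1) (c + 1) h,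
      hjCont_twos n (s + 2) c fun i h₁ h₂ => h i (by omega) (by omega)]
    push_cast
    ring

theorem hjCont_twos_three_twos (n : ℕ → ℤ) (s b c : ℕ) (h₃ : n (s + b + 1) = 3)
    (h : ∀ i, s < i → i ≤ s + b + 1 + c → i ≠ s + b + 1 → n i = 2) :
    hjCont n s (b + (c + 1)) = b * (c + 2) + 2 * c + 3 := by
  rw [hjCont_twos_add n s b c fun i h₁ h₂ => h i h₁ (by omega) (by omega),
    hjCont_three_twos n (s + b) c h₃ fun i h₁ h₂ => h i (by omega) h₂ (by omega),
    hjCont_twos n (s + b + 1) c fun i h₁ h₂ => h i (by omega) h₂ (by omega)]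
  ring

/-- Lemma 3.11(2): for the string `[2, …, 2, 3, 2, …, 2, 3, 2, …, 2]` with `α` twos,
a `3`, `β` twos, a `3`, and `γ` twos (`α ≥ 0`, `β ≥ 1`, `γ ≥ 0`):
`q = αβγ + 2αβ + 3αγ + 2βγ + 5α + 4β + 5γ + 8`,
`u_{α+1} + u_{α+2} + v_{α+1} + v_{α+2} = 2βγ + 3α + 4β + 3γ + 8`, and
`q ≥ u_{α+1} + u_{α+2} + v_{α+1} + v_{α+2}`. -/
theorem hj_two_threes (α β γ : ℕ) (hβ : 1 ≤ β)
    (l : ℕ) (hl : l = α + β + γ + 2) (n : ℕ → ℤ)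
    (hn : ∀ i, 1 ≤ i → i ≤ l →
      n i = if i = α + 1 ∨ i = α + β + 2 then 3 else 2) :
    HJq l n = (α : ℤ) * β * γ + 2 * α * β + 3 * α * γ + 2 * β * γ
        + 5 * α + 4 * β + 5 * γ + 8 ∧
    HJu n (α + 1) + HJu n (α + 2) + HJv l n (α + 1) + HJv l n (α + 2)
      = 2 * (β : ℤ) * γ + 3 * α + 4 * β + 3 * γ + 8 ∧
    HJu n (α + 1) + HJu n (α + 2) + HJv l n (α + 1) + HJv l n (α + 2) ≤ HJq l n := by
  obtain ⟨b, rfl⟩ : ∃ b, β = b + 1 := ⟨β - 1, by omega⟩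
  have two (i : ℕ) (h₁ : 1 ≤ i) (h₂ : i ≤ l) (h₃ : i ≠ α + 1) (h₄ : i ≠ α + (b + 1) + 2) :
      n i = 2 := by
    rw [hn i h₁ h₂, if_neg (by omega)]
  have three₁ : n (α + 1) = 3 := by rw [hn _ (by omega) (by omega), if_pos (.inl rfl)]
  have three₂ : n (α + (b + 1) + 2) = 3 := by rw [hn _ (by omega) (by omega), if_pos (.inr rfl)]
  have hu₁ : hjCont n 0 α = α + 1 :=
    hjCont_twos n 0 α fun i _ _ => two i (by omega) (by omega) (by omega) (by omega)
  have hu₂ : hjCont n 0 (α + 1) = 2 * α + 3 := by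
    rw [hjCont_twos_three_twos n 0 α 0 (by rwa [zero_add])
      fun i _ _ _ => two i (by omega) (by omega) (by omega) (by omega)]
    push_cast
    ring
  have hv₁ : hjCont n (α + 1) (b + 1 + (γ + 1)) = (b + 1) * (γ + 2) + 2 * γ + 3 := by
    rw [hjCont_twos_three_twos n (α + 1) (b + 1) γ
      (by rw [← three₂]; congr 1; omega)
      fun i _ _ _ => two i (by omega) (by omega) (by omega) (by omega)]
    push_cast
    ring
  have hv₂ : hjCont n (α + 2) (b + (γ + 1)) = b * (γ + 2) + 2 * γ + 3 :=
    hjCont_twos_three_twos n (α + 2) b γ (by rw [← three₂]; congr 1; omega)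
      fun i _ _ _ => two i (by omega) (by omega) (by omega) (by omega)
  have hq : hjCont n 0 l = α * (b + 1) * γ + 2 * α * (b + 1) + 3 * α * γ + 2 * (b + 1) * γ
      + 5 * α + 4 * (b + 1) + 5 * γ + 8 := by
    rw [show l = α + (b + (γ + 1) + 1 + 1) by omega,
      hjCont_twos_add n 0 α _ fun i _ _ => two i (by omega) (by omega) (by omega) (by omega),
      zero_add, hjCont_add_two, three₁, hv₂,
      show b + (γ + 1) + 1 = b + 1 + (γ + 1) by omega, hv₁]
    ring
  have eu (s : ℕ) : HJu n (s + 1) = |hjCont n 0 s| := by simp [abs_hjCont, HJu]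
  have ev (s k : ℕ) (h : l = s + k) : HJv l n s = |hjCont n s k| := by
    rw [abs_hjCont, HJv, if_pos (by omega), show l - s = k by omega]
  have eq : HJq l n = |hjCont n 0 l| := by simp [abs_hjCont, HJq]
  rw [eu α, eu (α + 1), ev (α + 1) (b + 1 + (γ + 1)) (by omega), ev (α + 2) (b + (γ + 1)) (by omega),
    eq, hu₁, hu₂, hv₁, hv₂, hq, abs_of_nonneg (by positivity), abs_of_nonneg (by positivity),
    abs_of_nonneg (by positivity), abs_of_nonneg (by positivity), abs_of_nonneg (by positivity)]
  push_cast
  refine ⟨by ring, by ring, ?_⟩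
  have : (0 : ℤ) ≤ α * (b + 1) * γ + 2 * α * (b + 1) + 3 * α * γ + 2 * α + 2 * γ := by positivity
  linarith
end

section
/- Let α ≥ β ≥ 0 be integers and consider the string [n_1, …, n_l] = [2, …, 2, 4, 2, …, 2] with α twos, then a 4, then β twos (so l = α + β + 1). Then q = 2αβ + 3α + 3β + 4 and q − (u_α + u_{α+1} + v_α + v_{α+1}) = 2αβ + α − β − 2. In particular q ≥ u_α + u_{α+1} + v_α + v_{α+1} unless (α, β) ∈ {(0,0), (1,0)}. -/
theorem HJMat_submatrix_succ (l : ℕ) (n : ℕ → ℤ) :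
    (HJMat (l + 1) n).submatrix Fin.succ Fin.succ = HJMat l (fun i => n (i + 1)) := by
  ext i j
  simp [HJMat]

theorem det_HJMat_succ_succ (l : ℕ) (n : ℕ → ℤ) :
    (HJMat (l + 2) n).det =
      -n 1 * (HJMat (l + 1) (fun i => n (i + 1))).det - (HJMat l (fun i => n (i + 2))).det := by
  have minor : ((HJMat (l + 2) n).submatrix Fin.succ (Fin.succAbove 1)).det =
      (HJMat l (fun i => n (i + 2))).det := by
    have inner : (((HJMat (l + 2) n).submatrix Fin.succ (Fin.succAbove 1)).submatrix
        (Fin.succAbove 0) Fin.succ) = HJMat l (fun i => n (i + 2)) := by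
      ext i j
      have h : (Fin.succAbove (1 : Fin (l + 2)) j.succ) = j.succ.succ := by
        rw [← Fin.succ_zero_eq_one, Fin.succ_succAbove_succ, Fin.succAbove_zero]
      simp only [Matrix.submatrix_apply, h]
      simp [HJMat]
    rw [Matrix.det_succ_column_zero, Fin.sum_univ_succ, inner, Finset.sum_eq_zero]
    · simp [HJMat]
    · intro i _
      simp [HJMat, Fin.ext_iff]
  rw [Matrix.det_succ_row_zero, Fin.sum_univ_succ, Fin.sum_univ_succ, Finset.sum_eq_zero]
  · rw [Fin.succ_zero_eq_one, minor, Fin.succAbove_zero, HJMat_submatrix_succ]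
    simp [HJMat]
    ring
  · intro i _
    simp [HJMat, Fin.ext_iff]

/-- The determinant of the string `[n₁, …, n_l]`, normalised by its sign. -/
def HJsignedDet (l : ℕ) (n : ℕ → ℤ) : ℤ := (-1) ^ l * (HJMat l n).det

theorem HJdet_eq_abs_HJsignedDet (l : ℕ) (n : ℕ → ℤ) : HJdet l n = |HJsignedDet l n| := by
  simp [HJdet, HJsignedDet, abs_mul]

theorem HJsignedDet_zero (n : ℕ → ℤ) : HJsignedDet 0 n = 1 := by
  simp [HJsignedDet]

theorem HJsignedDet_one (n : ℕ → ℤ) : HJsignedDet 1 n = n 1 := by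
  simp [HJsignedDet, HJMat]

theorem HJsignedDet_succ_succ (l : ℕ) (n : ℕ → ℤ) :
    HJsignedDet (l + 2) n =
      n 1 * HJsignedDet (l + 1) (fun i => n (i + 1)) - HJsignedDet l (fun i => n (i + 2)) := by
  simp only [HJsignedDet, det_HJMat_succ_succ]
  ring

theorem HJsignedDet_twos (l : ℕ) (n : ℕ → ℤ) (hn : ∀ i < l, n (i + 1) = 2) :
    HJsignedDet l n = l + 1 := by
  induction l using Nat.twoStepInduction generalizing n with
  | zero => simp [HJsignedDet_zero]
  | one => simp [HJsignedDet_one, hn 0]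
  | more l ih₀ ih₁ =>
    rw [HJsignedDet_succ_succ, ih₁ _ fun i hi => hn (i + 1) (by lia),
      ih₀ _ fun i hi => hn (i + 2) (by lia), hn 0 (by lia)]
    push_cast
    ring

theorem HJsignedDet_four_twos (b : ℕ) (n : ℕ → ℤ) (h4 : n 1 = 4)
    (hn : ∀ i < b, n (i + 2) = 2) : HJsignedDet (b + 1) n = 3 * b + 4 := by
  cases b with
  | zero => simp [HJsignedDet_one, h4]
  | succ b =>
    rw [HJsignedDet_succ_succ, HJsignedDet_twos _ _ fun i hi => hn i hi,
      HJsignedDet_twos _ _ fun i hi => hn (i + 1) (by lia), h4]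
    push_cast
    ring

theorem HJsignedDet_twos_four_twos (a b : ℕ) (n : ℕ → ℤ)
    (hn : ∀ i < a + b + 1, n (i + 1) = if i = a then 4 else 2) :
    HJsignedDet (a + b + 1) n = 2 * a * b + 3 * a + 3 * b + 4 := by
  induction a using Nat.twoStepInduction generalizing n with
  | zero =>
    rw [Nat.zero_add, HJsignedDet_four_twos b n (by simpa using hn 0)
      fun i hi => by simpa using hn (i + 1) (by lia)]
    push_cast
    ring
  | one =>
    rw [show 1 + b + 1 = b + 2 by ring, HJsignedDet_succ_succ,
      HJsignedDet_four_twos b _ (by simpa using hn 1 (by lia))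
        fun i hi => by simpa using hn (i + 2) (by lia),
      HJsignedDet_twos b _ fun i hi => by simpa using hn (i + 2) (by lia),
      show n 1 = 2 by simpa using hn 0 (by lia)]
    push_cast
    ring
  | more a ih₀ ih₁ =>
    rw [show a + 2 + b + 1 = (a + b + 1) + 2 by ring, HJsignedDet_succ_succ,
      show a + b + 1 + 1 = a + 1 + b + 1 by ring,
      ih₁ _ fun i hi => by simpa using hn (i + 1) (by lia),
      ih₀ _ fun i hi => by simpa using hn (i + 2) (by lia),
      show n 1 = 2 by simpa using hn 0 (by lia)]
    push_cast
    ring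

/-- Lemma 3.11(3): for the string `[2, …, 2, 4, 2, …, 2]` with `α` twos, a `4`, and
`β` twos (`α ≥ β ≥ 0`): `q = 2αβ + 3α + 3β + 4` and
`q - (u_α + u_{α+1} + v_α + v_{α+1}) = 2αβ + α - β - 2`; in particular
`q ≥ u_α + u_{α+1} + v_α + v_{α+1}` unless `(α, β) ∈ {(0,0), (1,0)}`. -/
theorem hj_twos_four_twos (α β : ℕ) (hαβ : β ≤ α)
    (l : ℕ) (hl : l = α + β + 1) (n : ℕ → ℤ)
    (hn : ∀ i, 1 ≤ i → i ≤ l → n i = if i = α + 1 then 4 else 2) :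
    HJq l n = 2 * (α : ℤ) * β + 3 * α + 3 * β + 4 ∧
    HJq l n - (HJu n α + HJu n (α + 1) + HJv l n α + HJv l n (α + 1))
      = 2 * (α : ℤ) * β + α - β - 2 ∧
    (¬(α = 0 ∧ β = 0) → ¬(α = 1 ∧ β = 0) →
      HJu n α + HJu n (α + 1) + HJv l n α + HJv l n (α + 1) ≤ HJq l n) := by
  subst hl
  have hq : HJq (α + β + 1) n = 2 * (α : ℤ) * β + 3 * α + 3 * β + 4 := by
    rw [HJq, HJdet_eq_abs_HJsignedDet, HJsignedDet_twos_four_twos α β n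
      fun i hi => by simpa using hn (i + 1) (by lia) (by lia)]
    exact abs_of_nonneg (by positivity)
  have hdet (s : ℕ) (hs : s ≤ α) : HJdet s n = s + 1 := by
    rw [HJdet_eq_abs_HJsignedDet, HJsignedDet_twos s n fun i hi => by
      rw [hn (i + 1) (by lia) (by lia), if_neg (by lia)]]
    exact abs_of_nonneg (by positivity)
  have hu₀ : HJu n α = α := by
    cases α with
    | zero => rfl
    | succ a => rw [HJu, hdet a (by lia)]; push_cast; ring
  have hu₁ : HJu n (α + 1) = α + 1 := hdet α le_rfl
  have hv₀ : HJv (α + β + 1) n α = 3 * β + 4 := by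
    rw [HJv, if_pos (by lia), show α + β + 1 - α = β + 1 by lia, HJdet_eq_abs_HJsignedDet,
      HJsignedDet_four_twos β _ (by rw [hn (α + 1) (by lia) (by lia), if_pos rfl])
        fun i hi => by rw [hn (α + (i + 2)) (by lia) (by lia), if_neg (by lia)]]
    exact abs_of_nonneg (by positivity)
  have hv₁ : HJv (α + β + 1) n (α + 1) = β + 1 := by
    rw [HJv, if_pos (by lia), show α + β + 1 - (α + 1) = β by lia, HJdet_eq_abs_HJsignedDet,
      HJsignedDet_twos β _ fun i hi => by
        rw [hn (α + 1 + (i + 1)) (by lia) (by lia), if_neg (by lia)]]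
    exact abs_of_nonneg (by positivity)
  rw [hq, hu₀, hu₁, hv₀, hv₁]
  refine ⟨rfl, by ring, fun h₀ h₁ => ?_⟩
  rcases Nat.eq_zero_or_pos β with rfl | hβ
  · push_cast
    lia
  · have : (1 : ℤ) ≤ β := by exact_mod_cast hβ
    have : (β : ℤ) ≤ α := by exact_mod_cast hαβ
    nlinarith
end
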